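/- arXiv:1211.2438 — 2 statements merged into one kernel-verified Lean document; each statement's English description precedes it below -/
import Mathlib

section
/- Fix α ∈ (0,1]. For every α-Hölder probability density ψ on S¹ (ψ ≥ 0, ∫ ψ dm = 1, H_α(ψ) < ∞) there exist a > 0 and N₁ ∈ ℕ such that Lⁿψ(x) ≥ a for all x ∈ S¹ and all n ≥ N₁. -/
open MeasureTheory Real


/-- `holderBound α f H` asserts that `H` is an upper bound for the `α`-Hölder
constant of `f`, i.e. `|f x - f y| ≤ H · d(x,y)^α` for all `x, y`. -/
def holderBound (α : ℝ) (f : UnitAddCircle → ℝ) (H : ℝ) : Prop :=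
  ∀ x y : UnitAddCircle, |f x - f y| ≤ H * dist x y ^ α


namespace EULB

/-- lifted transfer operator -/
noncomputable def P (F g : ℝ → ℝ) (w : ℕ) (u : ℝ → ℝ) (x : ℝ) : ℝ :=
  ∑ j ∈ Finset.range w, u (g (x + j)) / deriv F (g (x + j))

lemma P_mono {F g : ℝ → ℝ} {w : ℕ} (h0 : ∀ x, 0 < deriv F x) {u v : ℝ → ℝ}
    (h : ∀ x, u x ≤ v x) (x : ℝ) : P F g w u x ≤ P F g w v x := by
  unfold P
  refine Finset.sum_le_sum fun j _ => ?_
  exact div_le_div_of_nonneg_right (h _) (h0 _).le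

lemma P_smul {F g : ℝ → ℝ} {w : ℕ} (c : ℝ) (u : ℝ → ℝ) :
    P F g w (fun x => c * u x) = fun x => c * P F g w u x := by
  funext x
  unfold P
  rw [Finset.mul_sum]
  exact Finset.sum_congr rfl fun j _ => mul_div_assoc _ _ _

lemma P_cone {F g : ℝ → ℝ} {w : ℕ} {lam B K : ℝ} (h0 : ∀ x, 1 ≤ deriv F x)
    (hlam : 0 < lam)
    (hB : ∀ x y, deriv F x ≤ deriv F y + B * |x - y|) (hB0 : 0 ≤ B)
    (hg : ∀ x y, lam * |g x - g y| ≤ |x - y|) (hK0 : 0 ≤ K) (hK : K + B = K * lam)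
    {u : ℝ → ℝ} (hu0 : ∀ x, 0 ≤ u x) (hu : ∀ x y, u x ≤ u y * exp (K * |x - y|)) (x y : ℝ) :
    P F g w u x ≤ P F g w u y * exp (K * |x - y|) := by
  unfold P
  rw [Finset.sum_mul]
  refine Finset.sum_le_sum fun j _ => ?_
  have e : |x - y| = |(x + j) - (y + j)| := by congr 1; ring
  rw [e]
  generalize x + (j:ℝ) = s
  generalize y + (j:ℝ) = t
  have hs := h0 (g s)
  have ht := h0 (g t)
  have h1 := hu (g s) (g t)
  have h2 : deriv F (g t) ≤ deriv F (g s) * exp (B * |g s - g t|) := by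
    have := hB (g t) (g s)
    rw [abs_sub_comm] at this
    have h3 := Real.add_one_le_exp (B * |g s - g t|)
    have h4 : 0 ≤ B * |g s - g t| := by positivity
    nlinarith
  have h5 : exp (K * |g s - g t|) * exp (B * |g s - g t|) ≤ exp (K * |s - t|) := by
    rw [← Real.exp_add]
    apply Real.exp_le_exp.2
    have := mul_le_mul_of_nonneg_left (hg s t) hK0
    calc _ = (K + B) * |g s - g t| := by ring
      _ = K * (lam * |g s - g t|) := by rw [hK]; ring
      _ ≤ _ := this
  rw [div_mul_eq_mul_div, div_le_div_iff₀ (by linarith) (by linarith)]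
  calc u (g s) * deriv F (g t)
      ≤ (u (g t) * exp (K * |g s - g t|)) * (deriv F (g s) * exp (B * |g s - g t|)) := by
        apply mul_le_mul h1 h2 (by linarith)
        exact mul_nonneg (hu0 _) (exp_pos _).le
    _ = u (g t) * deriv F (g s) * (exp (K * |g s - g t|) * exp (B * |g s - g t|)) := by ring
    _ ≤ u (g t) * deriv F (g s) * exp (K * |s - t|) := by
        apply mul_le_mul_of_nonneg_left h5
        exact mul_nonneg (hu0 _) (by linarith)
    _ = _ := by ring

lemma P_cont {F g : ℝ → ℝ} {w : ℕ} (hF1 : Continuous (deriv F)) (h0 : ∀ x, 1 ≤ deriv F x)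
    (hg : Continuous g) {u : ℝ → ℝ} (hu : Continuous u) : Continuous (P F g w u) := by
  unfold P
  refine continuous_finset_sum _ fun j _ => ?_
  refine Continuous.div (by fun_prop) (by fun_prop) fun x => ?_
  linarith [h0 (g (x + j))]

lemma P_periodic {F g : ℝ → ℝ} {w : ℕ} (hF' : Function.Periodic (deriv F) 1)
    (hg : ∀ x, g (x + w) = g x + 1) {u : ℝ → ℝ} (hu : Function.Periodic u 1) :
    Function.Periodic (P F g w u) 1 := by
  intro x
  unfold P
  set h : ℕ → ℝ := fun j => u (g (x + j)) / deriv F (g (x + j)) with hh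
  have e1 : ∀ j : ℕ, u (g (x + 1 + j)) / deriv F (g (x + 1 + j)) = h (j + 1) := by
    intro j
    simp only [hh]
    have : x + 1 + (j:ℝ) = x + ((j + 1 : ℕ) : ℝ) := by push_cast; ring
    rw [this]
  rw [Finset.sum_congr rfl fun j _ => e1 j]
  have a := Finset.sum_range_succ h w
  have b := Finset.sum_range_succ' h w
  have c : h w = h 0 := by
    simp only [hh, hg, hu (g x), hF' (g x), Nat.cast_zero, add_zero]
  change _ = ∑ j ∈ Finset.range w, h j
  linarith

lemma P_integral {F g : ℝ → ℝ} {w : ℕ} (hF : ContDiff ℝ 2 F) (hF1 : Continuous (deriv F))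
    (h0 : ∀ x, 1 ≤ deriv F x)
    (hFw : ∀ x : ℝ, F (x + 1) = F x + w)
    (hgc : Continuous g) (hgF : ∀ x, g (F x) = x) (hFg : ∀ x, F (g x) = x)
    {u : ℝ → ℝ} (hu : Continuous u) (hup : Function.Periodic u 1) :
    ∫ x in (0:ℝ)..1, P F g w u x = ∫ x in (0:ℝ)..1, u x := by
  set h : ℝ → ℝ := fun s => u (g s) / deriv F (g s) with hh
  have hc : Continuous h := by
    refine Continuous.div (by fun_prop) (by fun_prop) fun x => ?_
    linarith [h0 (g x)]
  have e1 : ∫ x in (0:ℝ)..1, P F g w u x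
      = ∑ j ∈ Finset.range w, ∫ x in (0:ℝ)..1, h (x + j) := by
    unfold P
    rw [intervalIntegral.integral_finset_sum]
    intro j _
    exact (hc.comp (by fun_prop : Continuous fun x : ℝ => x + j)).intervalIntegrable _ _
  have e2 : ∑ j ∈ Finset.range w, ∫ x in (0:ℝ)..1, h (x + j) = ∫ x in (0:ℝ)..w, h x := by
    have := intervalIntegral.sum_integral_adjacent_intervals (f := h) (μ := volume)
      (a := fun k : ℕ => (k:ℝ)) (n := w) (fun k _ => hc.intervalIntegrable _ _)
    simp only [Nat.cast_zero] at this
    rw [← this]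
    refine Finset.sum_congr rfl fun j _ => ?_
    rw [intervalIntegral.integral_comp_add_right]
    congr 1 <;> push_cast <;> ring
  have e3 : ∫ x in (g 0)..(g 0 + 1), (h ∘ F) x * deriv F x = ∫ x in F (g 0)..F (g 0 + 1), h x := by
    apply intervalIntegral.integral_comp_mul_deriv
    · intro x _
      exact (hF.differentiable (by norm_num) x).hasDerivAt
    · exact hF1.continuousOn
    · exact hc
  have e4 : ∀ x, (h ∘ F) x * deriv F x = u x := by
    intro x
    simp only [hh, Function.comp, hgF]
    have := h0 x
    field_simp
  simp only [e4] at e3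
  rw [hFw, hFg, zero_add] at e3
  rw [e1, e2, ← e3, hup.intervalIntegral_add_eq (g 0) 0, zero_add]

lemma P_lower {F g : ℝ → ℝ} {w : ℕ} {M : ℝ} (hw : 0 < w) (h0 : ∀ x, 1 ≤ deriv F x)
    (hM : ∀ x, deriv F x ≤ M)
    (hF' : Function.Periodic (deriv F) 1)
    (hg : ∀ x, g (x + w) = g x + 1) (hgF : ∀ x, g (F x) = x) {u : ℝ → ℝ}
    (hup : Function.Periodic u 1) (hu0 : ∀ x, 0 ≤ u x) (y : ℝ) :
    u y / M ≤ P F g w u (F y) := by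
  have h1 := h0 y
  have h2 := hM y
  have : u (g (F y + (0:ℕ))) / deriv F (g (F y + (0:ℕ))) ≤ P F g w u (F y) := by
    unfold P
    refine Finset.single_le_sum (f := fun j : ℕ => u (g (F y + j)) / deriv F (g (F y + j)))
      (fun j _ => ?_) (Finset.mem_range.2 hw)
    exact div_nonneg (hu0 _) (by linarith [h0 (g (F y + j))])
  simp only [Nat.cast_zero, add_zero, hgF] at this
  refine le_trans ?_ this
  exact div_le_div_of_nonneg_left (hu0 _) (by linarith) h2

lemma L_eq (F g : ℝ → ℝ) (w : ℕ) (hw : 0 < w)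
    (hFw : ∀ x : ℝ, F (x + 1) = F x + w)
    (hgF : ∀ x, g (F x) = x) (hFg : ∀ x, F (g x) = x)
    (T : UnitAddCircle → UnitAddCircle) (hT : ∀ x : ℝ, T ↑x = (↑(F x) : UnitAddCircle))
    (T' : UnitAddCircle → ℝ) (hT'lift : ∀ x : ℝ, T' ↑x = deriv F x)
    (u : UnitAddCircle → ℝ) (x : ℝ) :
    ∑' y : (T ⁻¹' {(x : UnitAddCircle)}), u y / T' y = P F g w (fun t => u t) x := by
  have hFz : ∀ (k : ℤ) (y : ℝ), F (y + k) = F y + k * w := by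
    intro k
    induction k using Int.induction_on with
    | zero => simp
    | succ i ih =>
      intro y
      have := hFw (y + i)
      have h2 := ih y
      push_cast at *
      rw [← add_assoc, this, h2]; ring
    | pred i ih =>
      intro y
      have := hFw (y + (-i - 1))
      have h2 := ih y
      push_cast at *
      have e : y + (-(i:ℝ) - 1) + 1 = y + -i := by ring
      rw [e, h2] at this
      linarith
  have hmem : ∀ j : ℕ, ((g (x + j) : ℝ) : UnitAddCircle) ∈ T ⁻¹' {(x : UnitAddCircle)} := by
    intro j
    simp only [Set.mem_preimage, Set.mem_singleton_iff, hT, hFg]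
    rw [AddCircle.coe_add]
    have : ((j:ℝ) : UnitAddCircle) = 0 := by
      rw [AddCircle.coe_eq_zero_iff]
      exact ⟨j, by simp⟩
    rw [this, add_zero]
  let φ : Fin w → (T ⁻¹' {(x : UnitAddCircle)}) := fun j => ⟨_, hmem j⟩
  have key : ∀ a b : ℝ, (a : UnitAddCircle) = b → ∃ k : ℤ, a = b + k := by
    intro a b h
    have : ((a - b : ℝ) : UnitAddCircle) = 0 := by rw [AddCircle.coe_sub, h, sub_self]
    rw [AddCircle.coe_eq_zero_iff] at this
    obtain ⟨k, hk⟩ := this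
    refine ⟨k, ?_⟩
    simp at hk
    linarith
  have hφ : Function.Bijective φ := by
    constructor
    · intro i j hij
      have h1 : ((g (x + (i:ℕ)) : ℝ) : UnitAddCircle) = (g (x + (j:ℕ)) : ℝ) :=
        congrArg Subtype.val hij
      obtain ⟨k, hk⟩ := key _ _ h1
      have h2 := hFz k (g (x + (j:ℕ)))
      rw [← hk, hFg, hFg] at h2
      have h3 : ((i:ℕ):ℤ) = (j:ℕ) + k * w := by
        have : (((i:ℕ):ℤ):ℝ) = (((j:ℕ) + k * w : ℤ) : ℝ) := by push_cast; linarith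
        exact_mod_cast this
      have hi := i.2
      have hj := j.2
      apply Fin.ext
      have h4 : ((i:ℕ):ℤ) % w = ((j:ℕ):ℤ) % w := by rw [h3, Int.add_mul_emod_self_right]
      rw [Int.emod_eq_of_lt (by omega) (by omega), Int.emod_eq_of_lt (by omega) (by omega)] at h4
      exact_mod_cast h4
    · rintro ⟨y, hy⟩
      induction y using QuotientAddGroup.induction_on with
      | H s =>
      have hy' : T ((s:ℝ) : UnitAddCircle) = (x : UnitAddCircle) := hy
      rw [hT] at hy'
      obtain ⟨m, hm⟩ := key _ _ hy'
      have hw' : (0:ℤ) < w := by exact_mod_cast hw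
      have hr0 := Int.emod_nonneg m hw'.ne'
      have hr1 := Int.emod_lt_of_pos m hw'
      have hmd := Int.emod_add_mul_ediv m w
      obtain ⟨r, hr⟩ := Int.eq_ofNat_of_zero_le hr0
      have hrw : r < w := by omega
      refine ⟨⟨r, hrw⟩, ?_⟩
      apply Subtype.ext
      change ((g (x + r) : ℝ) : UnitAddCircle) = (s : UnitAddCircle)
      have h5 : F (s + ((-(m / w) : ℤ) : ℝ)) = x + r := by
        rw [hFz, hm]
        have : (m:ℝ) = r + w * ((m / w : ℤ) : ℝ) := by
          rw [hr] at hmd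
          have : ((m:ℤ):ℝ) = (((r:ℤ) + w * (m / w) : ℤ) : ℝ) := by rw [hmd]
          push_cast at this
          exact_mod_cast this
        rw [Int.cast_neg]
        linarith
      rw [← h5, hgF, AddCircle.coe_add]
      have : (((-(m / w) : ℤ) : ℝ) : UnitAddCircle) = 0 := by
        rw [AddCircle.coe_eq_zero_iff]
        exact ⟨-(m/w), by simp⟩
      rw [this, add_zero]
  rw [← (Equiv.ofBijective φ hφ).tsum_eq, tsum_fintype]
  unfold P
  rw [← Fin.sum_univ_eq_sum_range (fun j => u (g (x + j) : ℝ) / deriv F (g (x + j))) w]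
  refine Finset.sum_congr rfl fun j _ => ?_
  change u (g (x + (j:ℕ)) : ℝ) / T' (g (x + (j:ℕ)) : ℝ) = _
  rw [hT'lift]

lemma per_bdd {f : ℝ → ℝ} (hf : Continuous f) (hp : Function.Periodic f 1) :
    ∃ B, 0 ≤ B ∧ ∀ x, |f x| ≤ B := by
  obtain ⟨B, hB⟩ := (isCompact_Icc (a := (0:ℝ)) (b := 1)).exists_bound_of_continuousOn
    hf.continuousOn
  have h : ∀ x, |f x| ≤ B := by
    intro x
    obtain ⟨y, hy, e⟩ := hp.exists_mem_Ico₀ one_pos x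
    rw [e]
    exact hB y ⟨hy.1, hy.2.le⟩
  exact ⟨B, le_trans (abs_nonneg _) (h 0), h⟩

end EULB

open EULB

theorem eventual_uniform_lower_bound
    (F : ℝ → ℝ) (hF : ContDiff ℝ 2 F)
    (w : ℕ) (hw : 0 < w) (hFw : ∀ x : ℝ, F (x + 1) = F x + w)
    (T : UnitAddCircle → UnitAddCircle) (hT : ∀ x : ℝ, T ↑x = (↑(F x) : UnitAddCircle))
    (lam : ℝ) (hlam : 1 < lam) (hexp : ∀ x : ℝ, lam ≤ deriv F x)
    (T' : UnitAddCircle → ℝ) (hT'lift : ∀ x : ℝ, T' ↑x = deriv F x)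
    (L : (UnitAddCircle → ℝ) → (UnitAddCircle → ℝ))
    (hL : ∀ u : UnitAddCircle → ℝ, ∀ x : UnitAddCircle,
      L u x = ∑' y : (T ⁻¹' {x}), u y / T' y)
    (α : ℝ) (hα : 0 < α) (hα1 : α ≤ 1)
    (ψ : UnitAddCircle → ℝ) (hpos : ∀ x, 0 ≤ ψ x) (hnorm : ∫ x, ψ x = 1)
    (Hψ : ℝ) (hH : holderBound α ψ Hψ) :
    ∃ a : ℝ, 0 < a ∧ ∃ N₁ : ℕ, ∀ n : ℕ, N₁ ≤ n → ∀ x, a ≤ (L^[n] ψ) x := by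
  have hF1 : ContDiff ℝ 1 (deriv F) := by
    have : ContDiff ℝ (1 + 1) F := by simpa [one_add_one_eq_two] using hF
    exact (contDiff_succ_iff_deriv.1 this).2.2
  have hFd : Differentiable ℝ F := hF.differentiable (by norm_num)
  have hFd1 : Differentiable ℝ (deriv F) := hF1.differentiable (by norm_num)
  have hF1c : Continuous (deriv F) := hF1.continuous
  have hF2c : Continuous (deriv (deriv F)) := hF1.continuous_deriv (by norm_num)
  have hp1 : Function.Periodic (deriv F) 1 := by
    intro x
    rw [← deriv_comp_add_const]
    simp only [hFw, deriv_add_const]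
  have hp2 : Function.Periodic (deriv (deriv F)) 1 := by
    intro x
    rw [← deriv_comp_add_const]
    congr 1
    funext y
    exact hp1 y
  have h0 : ∀ x, 1 ≤ deriv F x := fun x => hlam.le.trans (hexp x)
  obtain ⟨M, hM0, hM'⟩ := per_bdd hF1c hp1
  have hM : ∀ x, deriv F x ≤ M := fun x => (le_abs_self _).trans (hM' x)
  have hMpos : 0 < M := by linarith [h0 0, hM 0]
  obtain ⟨B, hB0, hB'⟩ := per_bdd hF2c hp2
  have hB : ∀ x y, deriv F x ≤ deriv F y + B * |x - y| := by
    intro x y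
    have := Convex.norm_image_sub_le_of_norm_deriv_le (f := deriv F) (s := Set.univ) (C := B)
      (x := y) (y := x) (fun z _ => hFd1 z) (fun z _ => hB' z) convex_univ trivial trivial
    rw [Real.norm_eq_abs, Real.norm_eq_abs] at this
    linarith [le_abs_self (deriv F x - deriv F y)]
  have hexpand : ∀ x y, x ≤ y → lam * (y - x) ≤ F y - F x := fun x y h =>
    mul_sub_le_image_sub_of_le_deriv hFd hexp h
  have hmono : StrictMono F := strictMono_of_deriv_pos fun x => by linarith [h0 x]
  have hsurj : Function.Surjective F := by
    apply hF.continuous.surjective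
    · refine Filter.tendsto_atTop_mono' _ (f₁ := fun x => F 0 + x) ?_
        (Filter.tendsto_atTop_add_const_left _ _ Filter.tendsto_id)
      filter_upwards [Filter.eventually_ge_atTop 0] with x hx
      have := hexpand 0 x hx
      nlinarith
    · refine Filter.tendsto_atBot_mono' _ (f₁ := fun x => F 0 + x) ?_
        (Filter.tendsto_atBot_add_const_left _ _ Filter.tendsto_id)
      filter_upwards [Filter.eventually_le_atBot 0] with x hx
      have := hexpand x 0 hx
      nlinarith
  let e := hmono.orderIsoOfSurjective F hsurj
  obtain ⟨g, hgc, hgF, hFg⟩ : ∃ g : ℝ → ℝ, Continuous g ∧ (∀ x, g (F x) = x) ∧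
      ∀ x, F (g x) = x :=
    ⟨e.symm, e.symm.continuous, fun x => e.symm_apply_apply x, fun x => e.apply_symm_apply x⟩
  have hgw : ∀ x, g (x + w) = g x + 1 := by
    intro x
    rw [← hgF (g x + 1), hFw, hFg]
  have hgl : ∀ x y, lam * |g x - g y| ≤ |x - y| := by
    intro x y
    rcases le_total (g x) (g y) with h | h
    · have := hexpand _ _ h
      rw [hFg, hFg] at this
      rw [abs_sub_comm, abs_of_nonneg (sub_nonneg.2 h), abs_sub_comm]
      exact this.trans (le_abs_self _)
    · have := hexpand _ _ h
      rw [hFg, hFg] at this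
      rw [abs_of_nonneg (sub_nonneg.2 h)]
      exact this.trans (le_abs_self _)
  -- iterates of the constant function
  set K := B / (lam - 1) with hKdef
  have hl1 : 0 < lam - 1 := by linarith
  have hK0 : 0 ≤ K := by positivity
  have hK : K + B = K * lam := by
    rw [hKdef]; field_simp; ring
  have hone : ∀ k : ℕ, Continuous ((P F g w)^[k] fun _ => 1) ∧
      Function.Periodic ((P F g w)^[k] fun _ => 1) 1 ∧
      (∀ x, 0 ≤ ((P F g w)^[k] fun _ => 1) x) ∧
      (∀ x y, ((P F g w)^[k] fun _ => 1) x ≤ ((P F g w)^[k] fun _ => 1) y * exp (K * |x - y|)) ∧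
      ∫ x in (0:ℝ)..1, ((P F g w)^[k] fun _ => 1) x = 1 := by
    intro k
    induction k with
    | zero =>
      refine ⟨continuous_const, fun x => rfl, fun x => zero_le_one, fun x y => ?_, ?_⟩
      · simp only [Function.iterate_zero, id, one_mul]
        exact Real.one_le_exp (by positivity)
      · simp
    | succ k ih =>
      obtain ⟨i1, i2, i3, i4, i5⟩ := ih
      rw [Function.iterate_succ_apply']
      refine ⟨P_cont hF1c h0 hgc i1, P_periodic hp1 hgw i2, fun x => ?_,
        P_cone h0 (by linarith) hB hB0 hgl hK0 hK i3 i4, ?_⟩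
      · exact Finset.sum_nonneg fun j _ => div_nonneg (i3 _) (by linarith [h0 (g (x + j))])
      · rw [P_integral hF hF1c h0 hFw hgc hgF hFg i1 i2, i5]
  have hlow : ∀ k : ℕ, ∀ x, exp (-K) ≤ ((P F g w)^[k] fun _ => 1) x := by
    intro k
    obtain ⟨i1, i2, i3, i4, i5⟩ := hone k
    generalize ((P F g w)^[k] fun _ => 1) = v at *
    intro x
    obtain ⟨y, hy, ey⟩ := i2.exists_mem_Ico₀ one_pos x
    rw [ey]
    have hz : ∀ z ∈ Set.Icc (0:ℝ) 1, v z ≤ v y * exp K := by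
      intro z hz
      refine (i4 z y).trans (mul_le_mul_of_nonneg_left (Real.exp_le_exp.2 ?_) (i3 y))
      have : |z - y| ≤ 1 := by
        rw [abs_le]; constructor <;> linarith [hz.1, hz.2, hy.1, hy.2]
      nlinarith
    have := intervalIntegral.integral_mono_on (μ := volume) (zero_le_one' ℝ)
      (i1.intervalIntegrable 0 1)
      (continuous_const.intervalIntegrable 0 1 : IntervalIntegrable (fun _ => v y * exp K) _ 0 1) hz
    rw [i5] at this
    simp at this
    rw [Real.exp_neg, inv_le_iff_one_le_mul₀ (exp_pos _)]
    exact this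
  -- the lifted iterates of ψ
  set U : ℕ → ℝ → ℝ := fun n t => (L^[n] ψ) (t : UnitAddCircle) with hU
  have hUs : ∀ n, U (n + 1) = P F g w (U n) := by
    intro n
    funext t
    simp only [hU, Function.iterate_succ_apply']
    rw [hL]
    exact L_eq F g w hw hFw hgF hFg T hT T' hT'lift _ t
  have hUp : ∀ n, Function.Periodic (U n) 1 := by
    intro n t
    simp only [hU]
    exact congrArg _ (AddCircle.coe_add_period 1 t)
  have hU0 : ∀ n x, 0 ≤ U n x := by
    intro n
    induction n with
    | zero => intro x; exact hpos _
    | succ n ih =>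
      intro x
      rw [hUs]
      exact Finset.sum_nonneg fun j _ => div_nonneg (ih _) (by linarith [h0 (g (x + j))])
  have hψc : Continuous ψ := by
    rw [continuous_iff_continuousAt]
    intro x
    rw [ContinuousAt, tendsto_iff_dist_tendsto_zero]
    refine squeeze_zero (fun _ => dist_nonneg) (fun y => ?_)
      (g := fun y => Hψ * dist y x ^ α) ?_
    · rw [Real.dist_eq]; exact hH y x
    · have : Continuous fun y => Hψ * dist y x ^ α := by
        refine continuous_const.mul (Continuous.rpow_const (by fun_prop) fun _ => Or.inr hα.le)
      have h := this.tendsto x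
      simpa [Real.zero_rpow hα.ne'] using h
  obtain ⟨x0, hx0⟩ : ∃ x, 0 < ψ x := by
    by_contra! h
    have : ψ = fun _ => 0 := by funext x; exact le_antisymm (h x) (hpos x)
    rw [this] at hnorm
    simp at hnorm
  obtain ⟨t0, rfl⟩ := QuotientAddGroup.mk_surjective x0
  have hUc : Continuous (U 0) := hψc.comp (AddCircle.continuous_mk' 1)
  set c := U 0 t0 / 2 with hc
  have ht0 : 0 < U 0 t0 := hx0
  have hcpos : 0 < c := by positivity
  obtain ⟨δ, hδ, hball⟩ := Metric.eventually_nhds_iff.1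
    (hUc.continuousAt.eventually_const_lt (show c < U 0 t0 by rw [hc]; linarith))
  have hind : ∀ n : ℕ, ∃ p q : ℝ, lam ^ n * (δ / 2) ≤ q - p ∧
      ∀ x ∈ Set.Icc p q, c / M ^ n ≤ U n x := by
    intro n
    induction n with
    | zero =>
      refine ⟨t0, t0 + δ / 2, by simp, fun x hx => ?_⟩
      have := hball (y := x) (by
        rw [Real.dist_eq, abs_of_nonneg (by linarith [hx.1])]
        linarith [hx.2])
      simpa using this.le
    | succ n ih =>
      obtain ⟨p, q, hpq, h⟩ := ih
      have hpq' : p ≤ q := by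
        have : 0 ≤ lam ^ n * (δ / 2) := by positivity
        linarith
      refine ⟨F p, F q, ?_, fun x hx => ?_⟩
      · refine le_trans ?_ (hexpand p q hpq')
        rw [pow_succ]
        nlinarith
      · have hy : g x ∈ Set.Icc p q := by
          constructor
          · rw [← hmono.le_iff_le, hFg]; exact hx.1
          · rw [← hmono.le_iff_le, hFg]; exact hx.2
        have h1 := P_lower hw h0 hM hp1 hgw hgF (hUp n) (hU0 n) (g x)
        rw [hFg, ← hUs] at h1
        refine le_trans ?_ h1
        rw [pow_succ, ← div_div]
        exact div_le_div_of_nonneg_right (h _ hy) hMpos.le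
  obtain ⟨N, hN⟩ := pow_unbounded_of_one_lt (2 / δ) hlam
  obtain ⟨p, q, hpq, hN2⟩ := hind N
  have hpq1 : p + 1 ≤ q := by
    rw [div_lt_iff₀ hδ] at hN
    linarith
  set b := c / M ^ N with hb
  have hbpos : 0 < b := by positivity
  have hbase : ∀ x, b ≤ U N x := by
    intro x
    obtain ⟨y, hy, ey⟩ := (hUp N).exists_mem_Ico one_pos x p
    rw [ey]
    exact hN2 y ⟨hy.1, by linarith [hy.2]⟩
  have hfin : ∀ k x, b * ((P F g w)^[k] fun _ => 1) x ≤ U (N + k) x := by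
    intro k
    induction k with
    | zero => intro x; simpa using hbase x
    | succ k ih =>
      intro x
      rw [← add_assoc, hUs, Function.iterate_succ_apply']
      have h1 := P_mono (g := g) (w := w) (fun x => lt_of_lt_of_le one_pos (h0 x)) ih x
      rw [P_smul] at h1
      exact h1
  refine ⟨b * exp (-K), by positivity, N, fun n hn x => ?_⟩
  obtain ⟨t, rfl⟩ := QuotientAddGroup.mk_surjective x
  obtain ⟨k, rfl⟩ := Nat.exists_eq_add_of_le hn
  exact (mul_le_mul_of_nonneg_left (hlow k t) hbpos.le).trans (hfin k t)
end

section
/- The invariant density φ is strictly positive: there exists a > 0 such that φ(x) ≥ a for all x ∈ S¹. -/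
open MeasureTheory Real

theorem invariant_density_strictly_positive
    (F : ℝ → ℝ) (hF : ContDiff ℝ 2 F)
    (w : ℕ) (hw : 0 < w) (hFw : ∀ x : ℝ, F (x + 1) = F x + w)
    (T : UnitAddCircle → UnitAddCircle) (hT : ∀ x : ℝ, T ↑x = (↑(F x) : UnitAddCircle))
    (lam : ℝ) (hlam : 1 < lam) (hexp : ∀ x : ℝ, lam ≤ deriv F x)
    (nT'' : ℝ) (hnT'' : nT'' = ⨆ x : ℝ, |deriv (deriv F) x|)
    (Omega : ℝ) (hOmega : Omega = nT'' / (lam * (lam - 1)))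
    (T' : UnitAddCircle → ℝ) (hT'lift : ∀ x : ℝ, T' ↑x = deriv F x)
    (L : (UnitAddCircle → ℝ) → (UnitAddCircle → ℝ))
    (hL : ∀ u : UnitAddCircle → ℝ, ∀ x : UnitAddCircle,
      L u x = ∑' y : (T ⁻¹' {x}), u y / T' y)
    (φ : UnitAddCircle → ℝ) (hφlip : LipschitzWith ((1 + Omega) ^ 2).toNNReal φ)
    (hφpos : ∀ x, 0 ≤ φ x) (hφnorm : ∫ x, φ x = 1) (hφinv : L φ = φ) :
    ∃ a : ℝ, 0 < a ∧ ∀ x, a ≤ φ x := by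
  have hd : Differentiable ℝ F := hF.differentiable (by norm_num)
  have hgrow : ∀ x y : ℝ, x ≤ y → lam * (y - x) ≤ F y - F x := fun x y hxy =>
    mul_sub_le_image_sub_of_le_deriv hd hexp hxy
  have hmono : StrictMono F := by
    intro x y hxy
    have h1 := hgrow x y hxy.le
    have h2 : 0 < lam * (y - x) := mul_pos (by linarith) (by linarith)
    linarith
  have hfin : ∀ c : ℝ, (T ⁻¹' {(c : UnitAddCircle)}).Finite := by
    intro c
    have h1 : ((fun n : ℤ => c + n) '' (Set.Icc ⌊F 0 - c⌋ ⌈F 1 - c⌉)).Finite :=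
      (Set.finite_Icc _ _).image _
    have h2 := h1.preimage (f := F) hmono.injective.injOn
    refine (h2.image (fun t : ℝ => (t : UnitAddCircle))).subset ?_
    intro y hy
    obtain ⟨t, rfl⟩ := QuotientAddGroup.mk_surjective y
    have hfr : ((Int.fract t : ℝ) : UnitAddCircle) = (t : UnitAddCircle) := by
      refine QuotientAddGroup.eq_iff_sub_mem.2 ⟨-⌊t⌋, ?_⟩
      have := Int.self_sub_floor t
      simp only [zsmul_eq_mul, Int.cast_neg, mul_one]
      linarith
    refine ⟨Int.fract t, ?_, hfr⟩
    have hy' : T (t : UnitAddCircle) = c := hy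
    rw [← hfr, hT] at hy'
    obtain ⟨n, hn⟩ := (QuotientAddGroup.eq_iff_sub_mem.1 hy')
    have hn' : F (Int.fract t) = c + n := by
      simp at hn; linarith
    have h0 := hmono.monotone (Int.fract_nonneg t)
    have h3 := hmono (Int.fract_lt_one t)
    refine ⟨n, ⟨?_, ?_⟩, hn'.symm⟩
    · have : ((⌊F 0 - c⌋ : ℤ) : ℝ) ≤ n := (Int.floor_le _).trans (by linarith)
      exact_mod_cast this
    · have : (n : ℝ) ≤ ((⌈F 1 - c⌉ : ℤ) : ℝ) := le_trans (by linarith) (Int.le_ceil _)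
      exact_mod_cast this
  have hdpos : ∀ x, 0 < deriv F x := fun x => by linarith [hexp x]
  have hTpos : ∀ y, 0 < T' y := by
    intro y
    obtain ⟨t, rfl⟩ := QuotientAddGroup.mk_surjective y
    have := hT'lift t
    exact this ▸ hdpos t
  have hstep : ∀ x : ℝ, 0 < φ (x : UnitAddCircle) → 0 < φ ((F x : ℝ) : UnitAddCircle) := by
    intro x hx
    haveI : Finite (T ⁻¹' {((F x : ℝ) : UnitAddCircle)}) := hfin (F x)
    have hs : Summable (fun y : (T ⁻¹' {((F x : ℝ) : UnitAddCircle)}) => φ y / T' y) :=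
      Summable.of_finite
    have h1 := hs.le_tsum ⟨(x : UnitAddCircle), hT x⟩
      (fun y _ => div_nonneg (hφpos _) (hTpos _).le)
    rw [← hL φ, hφinv] at h1
    exact lt_of_lt_of_le (div_pos hx (hTpos _)) h1
  have hcont : Continuous φ := hφlip.continuous
  obtain ⟨x1, hx1⟩ : ∃ x : UnitAddCircle, 0 < φ x := by
    by_contra! h
    have : φ = fun _ => 0 := funext fun x => le_antisymm (h x) (hφpos x)
    rw [this] at hφnorm
    simp at hφnorm
  obtain ⟨t1, rfl⟩ := QuotientAddGroup.mk_surjective x1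
  have hcl : Continuous (fun t : ℝ => φ (t : UnitAddCircle)) :=
    hcont.comp (AddCircle.continuous_mk' 1)
  obtain ⟨e, he, hball⟩ := Metric.isOpen_iff.1 (isOpen_lt continuous_const hcl) t1 hx1
  have hI : ∀ t ∈ Set.Icc t1 (t1 + e / 2), 0 < φ (t : UnitAddCircle) := by
    intro t ht
    apply hball
    rw [Metric.mem_ball, Real.dist_eq, abs_lt]
    constructor <;> linarith [ht.1, ht.2]
  have hit : ∀ n : ℕ, ∃ a b : ℝ, lam ^ n * (e / 2) ≤ b - a ∧
      ∀ t ∈ Set.Icc a b, 0 < φ (t : UnitAddCircle) := by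
    intro n
    induction n with
    | zero => exact ⟨t1, t1 + e / 2, by simp, hI⟩
    | succ n ih =>
      obtain ⟨a, b, hab, h⟩ := ih
      have hpos : 0 < lam ^ n * (e / 2) := by positivity
      have hle : a ≤ b := by linarith
      refine ⟨F a, F b, ?_, ?_⟩
      · refine le_trans ?_ (hgrow a b hle)
        rw [pow_succ]
        nlinarith
      · intro t ht
        obtain ⟨s, hs, rfl⟩ := intermediate_value_Icc hle hd.continuous.continuousOn ht
        exact hstep s (h s hs)
  have hall : ∀ x, 0 < φ x := by
    intro x
    obtain ⟨n, hn⟩ := pow_unbounded_of_one_lt (1 / (e / 2)) hlam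
    obtain ⟨a, b, hab, h⟩ := hit n
    have h1 : 1 < lam ^ n * (e / 2) := by rwa [div_lt_iff₀ (by positivity)] at hn
    obtain ⟨t, ht, rfl⟩ : x ∈ (fun t : ℝ => (t : UnitAddCircle)) '' Set.Icc a (a + 1) := by
      have := AddCircle.coe_image_Icc_eq (1 : ℝ) a
      exact this ▸ Set.mem_univ x
    exact h t ⟨ht.1, by linarith [ht.2]⟩
  obtain ⟨z, -, hz⟩ := isCompact_univ.exists_isMinOn Set.univ_nonempty hcont.continuousOn
  exact ⟨φ z, hall z, fun x => hz (Set.mem_univ x)⟩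
end
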